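/- Let L_W be an ε-fuzzy Lawvere Laplacian where ε ∈ Q is idempotent (ε·ε = ε), and let q ∈ Q. Then x ∈ C⁰F is an (ε·q)-suffix point of L_W (i.e. ε·q ≤ hom_{C⁰F}(x, L_W x)) if and only if W(v,w)·ε·q ≤ hom_{Fe}(F_{v◁e} x_v, F_{w◁e} x_w) for every edge e and every ordered pair of its endpoints v, w. -/

import Mathlib

/- `Q` is a commutative unital quantale: `[CommMonoid Q] [CompleteLattice Q] [IsQuantale Q]`
(Mathlib's `IsQuantale` says multiplication distributes over arbitrary suprema).
Semicartesianness (`∀ p q, p * q ≤ p ⊓ q`) is taken as an explicit hypothesis where needed. -/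

universe u v w

/-- The internal hom `[p,q] := ⨆ {r | p·r ≤ q}` of a quantale. -/
def qhom {Q : Type v} [CompleteLattice Q] [Mul Q] (p q : Q) : Q := sSup {r | p * r ≤ q}

section QCat

variable {Q : Type v} [CompleteLattice Q] [CommMonoid Q] {A : Type u}

/-- A `Q`-category structure on `A` given by a `Q`-valued hom. -/
structure IsQCategory (hom : A → A → Q) : Prop where
  hom_self : ∀ x, hom x x = 1
  comp : ∀ x y z, hom x y * hom y z ≤ hom x z

/-- `m` is the meet of `S` weighted by `W`. -/
def IsWeightedMeet (hom : A → A → Q) {ι : Type w} (S : ι → A) (W : ι → Q) (m : A) : Prop :=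
  ∀ x, hom x m = ⨅ c, qhom (W c) (hom x (S c))

/-- `j` is the join of `S` weighted by `W`. -/
def IsWeightedJoin (hom : A → A → Q) {ι : Type w} (S : ι → A) (W : ι → Q) (j : A) : Prop :=
  ∀ x, hom j x = ⨅ c, qhom (W c) (hom (S c) x)

/-- The `Q`-category has all weighted meets. -/
def HasAllWeightedMeets (hom : A → A → Q) : Prop :=
  ∀ (ι : Type u) (S : ι → A) (W : ι → Q), ∃ m, IsWeightedMeet hom S W m

/-- The `Q`-category has all weighted joins. -/
def HasAllWeightedJoins (hom : A → A → Q) : Prop :=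
  ∀ (ι : Type u) (S : ι → A) (W : ι → Q), ∃ j, IsWeightedJoin hom S W j

end QCat

section Lap

variable (Q : Type v) [CompleteLattice Q] [CommMonoid Q]

/-- A network sheaf/cosheaf pair on a finite simple undirected graph `G = (V,E)`:
weighted-lattice stalks `Fv`, `Fe` over vertices and edges, restriction `Q`-functors
`F_{v◁e} : Fv → Fe` and extension `Q`-functors `F̄_{e▷v} : Fe → Fv` for each incidence
`v ◁ e` (i.e. `v ∈ ∂e`). -/
structure LapSetup where
  /-- vertices -/
  V : Type u
  /-- edges -/
  E : Type u
  finV : Finite V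
  finE : Finite E
  /-- `incid e v` means `v ◁ e`, i.e. `v ∈ ∂e` -/
  incid : E → V → Prop
  /-- every edge has exactly two distinct endpoints -/
  two_ends : ∀ e : E, ∃ v w : V, v ≠ w ∧ ∀ u, incid e u ↔ (u = v ∨ u = w)
  /-- the graph is simple: an edge is determined by its endpoints -/
  simple : ∀ e e' : E, (∀ v, incid e v ↔ incid e' v) → e = e'
  /-- vertex stalks -/
  Fv : V → Type u
  /-- edge stalks -/
  Fe : E → Type u
  homV : ∀ v, Fv v → Fv v → Q
  homE : ∀ e, Fe e → Fe e → Q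
  catV : ∀ v, IsQCategory (homV v)
  catE : ∀ e, IsQCategory (homE e)
  meetsV : ∀ v, HasAllWeightedMeets (homV v)
  joinsV : ∀ v, HasAllWeightedJoins (homV v)
  meetsE : ∀ e, HasAllWeightedMeets (homE e)
  joinsE : ∀ e, HasAllWeightedJoins (homE e)
  /-- restriction `F_{v◁e} : Fv → Fe` -/
  res : ∀ {e v}, incid e v → Fv v → Fe e
  /-- extension `F̄_{e▷v} : Fe → Fv` -/
  ext : ∀ {e v}, incid e v → Fe e → Fv v
  res_functor : ∀ {e v} (h : incid e v) (a b : Fv v), homV v a b ≤ homE e (res h a) (res h b)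
  ext_functor : ∀ {e v} (h : incid e v) (a b : Fe e), homE e a b ≤ homV v (ext h a) (ext h b)

variable {Q}

/-- 0-cochains `C⁰F = ∏_v Fv`. -/
abbrev Cochain (D : LapSetup Q) : Type u := ∀ v : D.V, D.Fv v

/-- The hom of the product `Q`-category `C⁰F`. -/
def C0hom (D : LapSetup Q) (x y : Cochain D) : Q := ⨅ v, D.homV v (x v) (y v)

/-- The index of the neighborhood family at `v`: pairs `(e, w)` with `v ◁ e ▷ w` and `w ≠ v`. -/
def NbIdx (D : LapSetup Q) (v : D.V) : Type u :=
  {p : D.E × D.V // D.incid p.1 v ∧ D.incid p.1 p.2 ∧ p.2 ≠ v}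

/-- `L` is a Lawvere Laplacian for `D` weighted by `W`: for every cochain `x` and vertex `v`,
`(L x)_v` is the meet of the family `F̄_{e▷v} (F_{w◁e} x_w)` (over `w ∈ N_v`, `∂e = {v,w}`)
weighted by `W(v,-)`. -/
def IsLawvereLaplacian (D : LapSetup Q) (W : D.V → D.V → Q)
    (L : Cochain D → Cochain D) : Prop :=
  ∀ (x : Cochain D) (v : D.V),
    IsWeightedMeet (D.homV v)
      (fun p : NbIdx D v => D.ext p.2.1 (D.res p.2.2.1 (x p.1.2)))
      (fun p => W v p.1.2) (L x v)

/-- The Laplacian data is `ε`-fuzzy: each restriction/extension pair `F_{v◁e} ⊣_ε F̄_{e▷v}`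
is an `ε`-fuzzy adjunction. -/
def IsFuzzyLap (D : LapSetup Q) (ε : Q) : Prop :=
  ∀ {e : D.E} {v : D.V} (h : D.incid e v) (a : D.Fv v) (b : D.Fe e),
    ε ≤ qhom (D.homE e (D.res h a) b) (D.homV v a (D.ext h b)) ∧
    ε ≤ qhom (D.homV v a (D.ext h b)) (D.homE e (D.res h a) b)

/-- The Laplacian data is crisp: each restriction/extension pair is a genuine `Q`-adjunction. -/
def IsCrispLap (D : LapSetup Q) : Prop :=
  ∀ {e : D.E} {v : D.V} (h : D.incid e v) (a : D.Fv v) (b : D.Fe e),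
    D.homE e (D.res h a) b = D.homV v a (D.ext h b)

/-- `x` is a `W`-fuzzy global section. -/
def IsGlobalSection (D : LapSetup Q) (W : D.V → D.V → Q) (x : Cochain D) : Prop :=
  ∀ {e : D.E} {v w : D.V} (hv : D.incid e v) (hw : D.incid e w), v ≠ w →
    W v w ≤ D.homE e (D.res hv (x v)) (D.res hw (x w))

end Lap

section Residuation

variable {Q : Type v} [CompleteLattice Q] [CommMonoid Q] [IsQuantale Q]

theorem le_qhom_iff {p q r : Q} : r ≤ qhom p q ↔ p * r ≤ q := by
  constructor
  · intro h
    refine (mul_le_mul_right h p).trans ?_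
    rw [qhom, mul_sSup_distrib]
    exact iSup₂_le fun _ hs => hs
  · intro h
    exact le_sSup h

theorem le_C0hom_laplacian_iff {D : LapSetup Q} {W : D.V → D.V → Q}
    {L : Cochain D → Cochain D} (hL : IsLawvereLaplacian D W L) (r : Q) (x : Cochain D) :
    r ≤ C0hom D x (L x) ↔
      ∀ {e : D.E} {v w : D.V} (hv : D.incid e v) (hw : D.incid e w), v ≠ w →
        W v w * r ≤ D.homV v (x v) (D.ext hv (D.res hw (x w))) := by
  rw [C0hom, le_iInf_iff]
  constructor
  · intro h e v w hv hw hvw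
    have h' := h v
    rw [hL x v (x v), le_iInf_iff] at h'
    exact le_qhom_iff.mp (h' ⟨(e, w), hv, hw, hvw.symm⟩)
  · intro h v
    rw [hL x v (x v), le_iInf_iff]
    rintro ⟨⟨e, w⟩, hv, hw, hwv⟩
    exact le_qhom_iff.mpr (h hv hw hwv.symm)

/-- An idempotent factor absorbs one residuation step. -/
theorem le_of_le_of_idempotent_le_qhom {ε a b c q : Q} (hidem : ε * ε = ε)
    (hε : ε ≤ qhom b c) (h : a * ε * q ≤ b) : a * ε * q ≤ c :=
  calc a * ε * q = a * ε * q * ε := by rw [mul_right_comm _ q ε, mul_assoc a ε ε, hidem]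
    _ ≤ b * ε := mul_le_mul_left h ε
    _ ≤ c := le_qhom_iff.mp hε

end Residuation

/-- For an `ε`-fuzzy Lawvere Laplacian with `ε` idempotent, `x` is an
`(ε·q)`-suffix point iff `W(v,w)·ε·q ≤ hom_{Fe}(F_{v◁e} x_v, F_{w◁e} x_w)` on every edge. -/
theorem suffix_iff_section_of_idempotent
    {Q : Type v} [CompleteLattice Q] [CommMonoid Q] [IsQuantale Q]
    (hsc : ∀ p q : Q, p * q ≤ p ⊓ q)
    (D : LapSetup Q) (W : D.V → D.V → Q) (L : Cochain D → Cochain D)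
    (hL : IsLawvereLaplacian D W L) (ε q : Q) (hε : IsFuzzyLap D ε)
    (hidem : ε * ε = ε) (x : Cochain D) :
    ε * q ≤ C0hom D x (L x) ↔
      ∀ {e : D.E} {v w : D.V} (hv : D.incid e v) (hw : D.incid e w), v ≠ w →
        W v w * ε * q ≤ D.homE e (D.res hv (x v)) (D.res hw (x w)) := by
  rw [le_C0hom_laplacian_iff hL]
  simp only [← mul_assoc]
  constructor
  · intro h e v w hv hw hvw
    exact le_of_le_of_idempotent_le_qhom hidem (hε hv _ _).2 (h hv hw hvw)
  · intro h e v w hv hw hvw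
    exact le_of_le_of_idempotent_le_qhom hidem (hε hv _ _).1 (h hv hw hvw)
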